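/- Urysohn-type consequence for indicator functions: if K is a convex body in ℝⁿ and K* = (w(K)/w(B_n)) B_n is the ball with the same mean width as K, then vol_n(K) ≤ (w(K)/w(B_n))ⁿ vol_n(B_n), i.e., vol_n(K) ≤ vol_n(K*). -/

import Mathlib

open RealInnerProductSpace MeasureTheory

/-- The mean width `w(K) = 2 ∫_{S^{n-1}} h_K(u) dσ(u)`, where `σ` is the normalized
surface measure on the unit sphere and `h_K(u) = sup_{x ∈ K} ⟪x,u⟫`. -/
noncomputable def meanWidth {n : ℕ} (K : Set (EuclideanSpace ℝ (Fin n))) : ℝ :=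
  2 * ⨍ u : Metric.sphere (0 : EuclideanSpace ℝ (Fin n)) 1,
      sSup ((fun x => ⟪x, (u : EuclideanSpace ℝ (Fin n))⟫) '' K)
    ∂((volume : Measure (EuclideanSpace ℝ (Fin n))).toSphere)

open scoped ENNReal Pointwise

theorem Real.volume_add_volume_le_of_isCompact {A B C : Set ℝ} (hA : IsCompact A)
    (hB : IsCompact B) (hA₀ : A.Nonempty) (hB₀ : B.Nonempty)
    (h : ∀ x ∈ A, ∀ y ∈ B, x + y ∈ C) : volume A + volume B ≤ volume C := by
  obtain ⟨p, hpA, hp⟩ := hA.exists_isGreatest hA₀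
  obtain ⟨q, hqB, hq⟩ := hB.exists_isLeast hB₀
  have hd : AEDisjoint volume ((fun x => x + q) '' A) ((fun y => p + y) '' B) := by
    refine measure_mono_null (t := {p + q}) ?_ (measure_singleton _)
    rintro _ ⟨⟨x, hx, rfl⟩, ⟨y, hy, hxy⟩⟩
    have h1 := hp hx
    have h2 := hq hy
    simp only [Set.mem_singleton_iff] at hxy ⊢
    linarith
  have hm : NullMeasurableSet ((fun y => p + y) '' B) :=
    (hB.image (by fun_prop)).measurableSet.nullMeasurableSet
  calc volume A + volume B
      = volume ((fun x => x + q) '' A) + volume ((fun y => p + y) '' B) := by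
        rw [Set.image_add_right, Set.image_add_left, measure_preimage_add_right,
          measure_preimage_add]
    _ = volume ((fun x => x + q) '' A ∪ (fun y => p + y) '' B) := (measure_union₀ hm hd).symm
    _ ≤ volume C := by
        refine measure_mono ?_
        rintro _ (⟨x, hx, rfl⟩ | ⟨y, hy, rfl⟩)
        · exact h _ hx _ hqB
        · exact h _ hpA _ hy

theorem MeasurableSet.measure_le_iSup_isCompact_nonempty {A : Set ℝ} (hA : MeasurableSet A) :
    volume A ≤ ⨆ (K : Set ℝ) (_ : K ⊆ A ∧ IsCompact K ∧ K.Nonempty), volume K := by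
  refine le_of_forall_lt fun r hr => ?_
  obtain ⟨K, hKA, hK, hr⟩ := hA.exists_lt_isCompact hr
  have hK₀ : K.Nonempty := nonempty_of_measure_ne_zero (ne_bot_of_gt hr)
  exact hr.trans_le (le_iSup₂_of_le K ⟨hKA, hK, hK₀⟩ le_rfl)

theorem Real.volume_add_volume_le {A B C : Set ℝ} (hA : MeasurableSet A)
    (hB : MeasurableSet B) (hA₀ : A.Nonempty) (hB₀ : B.Nonempty)
    (h : ∀ x ∈ A, ∀ y ∈ B, x + y ∈ C) : volume A + volume B ≤ volume C := by
  refine (add_le_add hA.measure_le_iSup_isCompact_nonempty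
    hB.measure_le_iSup_isCompact_nonempty).trans ?_
  obtain ⟨x, hx⟩ := hA₀
  obtain ⟨y, hy⟩ := hB₀
  refine ENNReal.biSup_add_biSup_le'
    ⟨{x}, by simpa using hx, isCompact_singleton, Set.singleton_nonempty x⟩
    ⟨{y}, by simpa using hy, isCompact_singleton, Set.singleton_nonempty y⟩ ?_
  rintro K ⟨hKA, hK, hK₀⟩ L ⟨hLB, hL, hL₀⟩
  exact volume_add_volume_le_of_isCompact hK hL hK₀ hL₀ fun x hx y hy => h x (hKA hx) y (hLB hy)

theorem Real.mul_volume_add_mul_volume_le {a b : ℝ} (ha : 0 < a) (hb : 0 < b) {A B C : Set ℝ}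
    (hA : MeasurableSet A) (hB : MeasurableSet B) (hA₀ : A.Nonempty) (hB₀ : B.Nonempty)
    (h : ∀ x ∈ A, ∀ y ∈ B, a * x + b * y ∈ C) :
    ENNReal.ofReal a * volume A + ENNReal.ofReal b * volume B ≤ volume C := by
  have := Real.volume_add_volume_le (hA.const_smul₀ a) (hB.const_smul₀ b)
    hA₀.smul_set hB₀.smul_set (C := C) (by
      rintro _ ⟨x, hx, rfl⟩ _ ⟨y, hy, rfl⟩
      exact h x hx y hy)
  simpa [Measure.addHaar_smul, abs_of_pos ha, abs_of_pos hb] using this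

theorem ENNReal.rpow_mul_rpow_le_mul_add_mul {a b : ℝ} (ha : 0 < a) (hb : 0 < b) (hab : a + b = 1)
    (x y : ℝ≥0∞) : x ^ a * y ^ b ≤ ENNReal.ofReal a * x + ENNReal.ofReal b * y := by
  rcases eq_or_ne x ∞ with rfl | hx
  · simp [ENNReal.mul_top, ha]
  rcases eq_or_ne y ∞ with rfl | hy
  · simp [ENNReal.mul_top, hb]
  lift x to NNReal using hx
  lift y to NNReal using hy
  have := NNReal.geom_mean_le_arith_mean2_weighted a.toNNReal b.toNNReal x y
    (by rw [← Real.toNNReal_add ha.le hb.le, hab, Real.toNNReal_one])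
  rw [Real.coe_toNNReal a ha.le, Real.coe_toNNReal b hb.le] at this
  rw [← ENNReal.coe_rpow_of_nonneg _ ha.le, ← ENNReal.coe_rpow_of_nonneg _ hb.le,
    ENNReal.ofReal, ENNReal.ofReal]
  exact_mod_cast this

/-- The one-dimensional Prékopa–Leindler inequality for functions with supremum one. -/
theorem lintegral_rpow_mul_le_of_sup_eq_one {a b : ℝ} (ha : 0 < a) (hb : 0 < b) (hab : a + b = 1)
    {f g h : ℝ → ℝ≥0∞} (hf : Measurable f) (hg : Measurable g) (hh : Measurable h)
    (hf₁ : ⨆ x, f x = 1) (hg₁ : ⨆ x, g x = 1)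
    (H : ∀ x y, f x ^ a * g y ^ b ≤ h (a * x + b * y)) :
    (∫⁻ x, f x) ^ a * (∫⁻ x, g x) ^ b ≤ ∫⁻ x, h x := by
  have layer : ∀ u : ℝ → ℝ≥0∞, Measurable u → (∀ x, u x ≤ 1) →
      ∫⁻ x, u x = ∫⁻ t in Set.Ioi (0 : ℝ), volume {x | ENNReal.ofReal t < u x} := by
    intro u hu hu₁
    have hu_top : ∀ x, u x ≠ ∞ := fun x => ne_top_of_le_ne_top ENNReal.one_ne_top (hu₁ x)
    have := lintegral_eq_lintegral_meas_lt volume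
      (Filter.Eventually.of_forall fun x => (u x).toReal_nonneg) hu.ennreal_toReal.aemeasurable
    simp only [ENNReal.ofReal_toReal (hu_top _)] at this
    rw [this]
    refine setLIntegral_congr_fun measurableSet_Ioi fun t ht => ?_
    simp only [ENNReal.ofReal_lt_iff_lt_toReal (le_of_lt ht) (hu_top _)]
  have hf_le : ∀ x, f x ≤ 1 := fun x => hf₁ ▸ le_iSup f x
  have hg_le : ∀ x, g x ≤ 1 := fun x => hg₁ ▸ le_iSup g x
  have hm : ∀ u : ℝ → ℝ≥0∞, Measurable fun t : ℝ => volume {x | ENNReal.ofReal t < u x} :=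
    fun u => Antitone.measurable fun s t hst =>
      measure_mono fun x hx => (ENNReal.ofReal_le_ofReal hst).trans_lt hx
  calc (∫⁻ x, f x) ^ a * (∫⁻ x, g x) ^ b
      ≤ ENNReal.ofReal a * (∫⁻ x, f x) + ENNReal.ofReal b * (∫⁻ x, g x) :=
        ENNReal.rpow_mul_rpow_le_mul_add_mul ha hb hab _ _
    _ = ∫⁻ t in Set.Ioi (0 : ℝ), (ENNReal.ofReal a * volume {x | ENNReal.ofReal t < f x} +
          ENNReal.ofReal b * volume {x | ENNReal.ofReal t < g x}) := by
        rw [lintegral_add_left ((hm f).const_mul _), lintegral_const_mul _ (hm f),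
          lintegral_const_mul _ (hm g), layer f hf hf_le, layer g hg hg_le]
    _ ≤ ∫⁻ t in Set.Ioi (0 : ℝ), volume {x | ENNReal.ofReal t < min (h x) 1} := by
        refine setLIntegral_mono (hm _) fun t ht => ?_
        rcases lt_or_ge (ENNReal.ofReal t) 1 with ht₁ | ht₁
        · obtain ⟨x₀, hx₀⟩ := lt_iSup_iff.1 (hf₁.symm ▸ ht₁)
          obtain ⟨y₀, hy₀⟩ := lt_iSup_iff.1 (hg₁.symm ▸ ht₁)
          refine Real.mul_volume_add_mul_volume_le ha hb (measurableSet_lt measurable_const hf)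
            (measurableSet_lt measurable_const hg) ⟨x₀, hx₀⟩ ⟨y₀, hy₀⟩ fun x hx y hy => ?_
          refine lt_min (lt_of_lt_of_le ?_ (H x y)) ht₁
          calc ENNReal.ofReal t = ENNReal.ofReal t ^ a * ENNReal.ofReal t ^ b := by
                rw [← ENNReal.rpow_add_of_nonneg _ _ ha.le hb.le, hab, ENNReal.rpow_one]
            _ < f x ^ a * g y ^ b :=
                ENNReal.mul_lt_mul (ENNReal.rpow_lt_rpow hx ha) (ENNReal.rpow_lt_rpow hy hb)
        · have h₁ : {x | ENNReal.ofReal t < f x} = ∅ :=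
            Set.eq_empty_of_forall_notMem fun x hx => ((hf_le x).trans ht₁).not_gt hx
          have h₂ : {x | ENNReal.ofReal t < g x} = ∅ :=
            Set.eq_empty_of_forall_notMem fun x hx => ((hg_le x).trans ht₁).not_gt hx
          simp [h₁, h₂]
    _ = ∫⁻ x, min (h x) 1 :=
        (layer _ (hh.min measurable_const) fun x => min_le_right _ _).symm
    _ ≤ ∫⁻ x, h x := lintegral_mono fun x => min_le_left _ _

/-- The Prékopa–Leindler inequality, as a property of a measure space with a linear structure. -/
def PrekopaLeindler (E : Type*) [AddCommGroup E] [Module ℝ E] [MeasureSpace E] : Prop :=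
  ∀ ⦃a b : ℝ⦄, 0 < a → 0 < b → a + b = 1 → ∀ ⦃f g h : E → ℝ≥0∞⦄,
    Measurable f → Measurable g → Measurable h →
    (∀ x y, f x ^ a * g y ^ b ≤ h (a • x + b • y)) →
    (∫⁻ x, f x) ^ a * (∫⁻ x, g x) ^ b ≤ ∫⁻ x, h x

theorem lintegral_rpow_mul_le_of_sup_ne_top {a b : ℝ} (ha : 0 < a) (hb : 0 < b) (hab : a + b = 1)
    {f g h : ℝ → ℝ≥0∞} (hf : Measurable f) (hg : Measurable g) (hh : Measurable h)
    (hf₁ : ⨆ x, f x ≠ ∞) (hg₁ : ⨆ x, g x ≠ ∞)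
    (H : ∀ x y, f x ^ a * g y ^ b ≤ h (a * x + b * y)) :
    (∫⁻ x, f x) ^ a * (∫⁻ x, g x) ^ b ≤ ∫⁻ x, h x := by
  set s := ⨆ x, f x with hs
  set t := ⨆ x, g x with ht
  rcases eq_or_ne s 0 with hs₀ | hs₀
  · have : ∀ x, f x = 0 := by simpa [hs₀] using hs.symm
    simp [this, ha]
  rcases eq_or_ne t 0 with ht₀ | ht₀
  · have : ∀ x, g x = 0 := by simpa [ht₀] using ht.symm
    simp [this, hb]
  have hc₀ : s ^ a * t ^ b ≠ 0 := by simp [hs₀, ht₀, hf₁, hg₁]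
  have hc : s ^ a * t ^ b ≠ ∞ := ENNReal.mul_ne_top
    (ENNReal.rpow_ne_top_of_nonneg ha.le hf₁) (ENNReal.rpow_ne_top_of_nonneg hb.le hg₁)
  have key : ∀ u v : ℝ≥0∞, (s⁻¹ * u) ^ a * (t⁻¹ * v) ^ b = (s ^ a * t ^ b)⁻¹ * (u ^ a * v ^ b) := by
    intro u v
    rw [ENNReal.mul_rpow_of_nonneg _ _ ha.le, ENNReal.mul_rpow_of_nonneg _ _ hb.le,
      ENNReal.inv_rpow, ENNReal.inv_rpow, ENNReal.mul_inv (by simp [hs₀, hf₁]) (by simp [ht₀, hg₁])]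
    ring
  have := lintegral_rpow_mul_le_of_sup_eq_one ha hb hab (hf.const_mul s⁻¹) (hg.const_mul t⁻¹)
    (hh.const_mul (s ^ a * t ^ b)⁻¹)
    (by rw [← ENNReal.mul_iSup, ← hs, ENNReal.inv_mul_cancel hs₀ hf₁])
    (by rw [← ENNReal.mul_iSup, ← ht, ENNReal.inv_mul_cancel ht₀ hg₁])
    (fun x y => by rw [key]; gcongr; exact H x y)
  rw [lintegral_const_mul _ hf, lintegral_const_mul _ hg, lintegral_const_mul _ hh, key] at this
  exact (ENNReal.mul_le_mul_iff_right (ENNReal.inv_ne_zero.2 hc) (ENNReal.inv_ne_top.2 hc₀)).1 this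

theorem tendsto_lintegral_min_natCast {f : ℝ → ℝ≥0∞} (hf : Measurable f) :
    Filter.Tendsto (fun N : ℕ => ∫⁻ x, min (f x) N) Filter.atTop (nhds (∫⁻ x, f x)) := by
  refine lintegral_tendsto_of_tendsto_of_monotone
    (fun N => (hf.min measurable_const).aemeasurable)
    (.of_forall fun x m n hmn => min_le_min_left _ (by exact_mod_cast hmn)) (.of_forall fun x => ?_)
  simpa using tendsto_const_nhds.min (ENNReal.tendsto_nat_nhds_top)

theorem PrekopaLeindler.real : PrekopaLeindler ℝ := by
  intro a b ha hb hab f g h hf hg hh H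
  rcases eq_or_ne (∫⁻ x, f x) 0 with hf₀ | hf₀
  · simp [hf₀, ha]
  rcases eq_or_ne (∫⁻ x, g x) 0 with hg₀ | hg₀
  · simp [hg₀, hb]
  refine le_of_tendsto' (ENNReal.Tendsto.mul
    (((ENNReal.continuous_rpow_const (y := a)).tendsto _).comp (tendsto_lintegral_min_natCast hf))
    (.inl (by simp [hf₀, ha, ha.le]))
    (((ENNReal.continuous_rpow_const (y := b)).tendsto _).comp (tendsto_lintegral_min_natCast hg))
    (.inl (by simp [hg₀, hb, hb.le]))) fun N => ?_
  have hN : ∀ u : ℝ → ℝ≥0∞, ⨆ x, min (u x) N ≠ ∞ := fun u =>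
    ne_top_of_le_ne_top (ENNReal.natCast_ne_top N) (iSup_le fun x => min_le_right _ _)
  refine lintegral_rpow_mul_le_of_sup_ne_top ha hb hab (hf.min measurable_const)
    (hg.min measurable_const) hh (hN f) (hN g) fun x y => le_trans ?_ (H x y)
  gcongr <;> exact min_le_left _ _

theorem PrekopaLeindler.prod {E F : Type*} [AddCommGroup E] [Module ℝ E] [MeasureSpace E]
    [AddCommGroup F] [Module ℝ F] [MeasureSpace F] [SFinite (volume : Measure F)]
    (hE : PrekopaLeindler E) (hF : PrekopaLeindler F) : PrekopaLeindler (E × F) := by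
  intro a b ha hb hab f g h hf hg hh H
  simp only [Measure.volume_eq_prod]
  rw [lintegral_prod _ hf.aemeasurable, lintegral_prod _ hg.aemeasurable,
    lintegral_prod _ hh.aemeasurable]
  exact hE ha hb hab hf.lintegral_prod_right' hg.lintegral_prod_right' hh.lintegral_prod_right'
    fun x y => hF ha hb hab (hf.comp measurable_prodMk_left) (hg.comp measurable_prodMk_left)
      (hh.comp measurable_prodMk_left) fun u v => H (x, u) (y, v)

theorem PrekopaLeindler.of_measurePreserving {E F : Type*} [AddCommGroup E] [Module ℝ E]
    [MeasureSpace E] [AddCommGroup F] [Module ℝ F] [MeasureSpace F] (hE : PrekopaLeindler E)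
    (L : E →ₗ[ℝ] F) (hL : MeasurePreserving L) : PrekopaLeindler F := by
  intro a b ha hb hab f g h hf hg hh H
  rw [← hL.lintegral_comp hf, ← hL.lintegral_comp hg, ← hL.lintegral_comp hh]
  exact hE ha hb hab (hf.comp hL.measurable) (hg.comp hL.measurable) (hh.comp hL.measurable)
    fun x y => by simpa using H (L x) (L y)

theorem PrekopaLeindler.pi (n : ℕ) : PrekopaLeindler (Fin n → ℝ) := by
  induction n with
  | zero =>
    intro a b ha hb hab f g h hf hg hh H
    rw [Measure.volume_pi_eq_dirac 0, lintegral_dirac, lintegral_dirac, lintegral_dirac]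
    simpa using H 0 0
  | succ n ih =>
    let L : (ℝ × (Fin n → ℝ)) →ₗ[ℝ] (Fin (n + 1) → ℝ) :=
      { toFun := fun p => Fin.cons p.1 p.2
        map_add' := fun p q => by ext i; refine Fin.cases ?_ (fun j => ?_) i <;> simp
        map_smul' := fun c p => by ext i; refine Fin.cases ?_ (fun j => ?_) i <;> simp }
    refine (PrekopaLeindler.real.prod ih).of_measurePreserving L ?_
    have hL : ⇑L = (MeasurableEquiv.piFinSuccAbove (fun _ : Fin (n + 1) => ℝ) 0).symm := by
      ext p i
      refine Fin.cases ?_ (fun j => ?_) i <;> simp [L]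
    rw [hL]
    exact (volume_preserving_piFinSuccAbove (fun _ : Fin (n + 1) => ℝ) 0).symm

theorem PrekopaLeindler.euclideanSpace (n : ℕ) : PrekopaLeindler (EuclideanSpace ℝ (Fin n)) :=
  (PrekopaLeindler.pi n).of_measurePreserving
    (WithLp.linearEquiv 2 ℝ (Fin n → ℝ)).symm.toLinearMap
    (PiLp.volume_preserving_toLp (Fin n))

/-- The multiplicative Brunn–Minkowski inequality. -/
theorem PrekopaLeindler.brunn_minkowski {E : Type*} [AddCommGroup E] [Module ℝ E] [MeasureSpace E]
    (hE : PrekopaLeindler E) {a b : ℝ} (ha : 0 < a) (hb : 0 < b) (hab : a + b = 1)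
    {A B C : Set E} (hA : MeasurableSet A) (hB : MeasurableSet B) (hC : MeasurableSet C)
    (h : ∀ x ∈ A, ∀ y ∈ B, a • x + b • y ∈ C) :
    volume A ^ a * volume B ^ b ≤ volume C := by
  have := hE ha hb hab (measurable_one.indicator hA) (measurable_one.indicator hB)
    (measurable_one.indicator hC) fun x y => by
      by_cases hx : x ∈ A
      · by_cases hy : y ∈ B
        · simp [hx, hy, h x hx y hy]
        · simp [hy, hb]
      · simp [hx, ha]
  simpa [lintegral_indicator_one, hA, hB, hC] using this

theorem measure_le_lintegral_toSphere {E : Type*} [NormedAddCommGroup E]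
    [NormedSpace ℝ E] [FiniteDimensional ℝ E] [Nontrivial E] [MeasurableSpace E] [BorelSpace E]
    (μ : Measure E) [μ.IsAddHaarMeasure] {C : Set E} {ρ : Metric.sphere (0 : E) 1 → ℝ}
    (hρ : Measurable ρ) (hρ₀ : ∀ u, 0 < ρ u)
    (h : ∀ u : Metric.sphere (0 : E) 1, ∀ r > 0, r • (u : E) ∈ C → r < ρ u) :
    μ C ≤ ∫⁻ u, ENNReal.ofReal (ρ u ^ Module.finrank ℝ E / Module.finrank ℝ E) ∂μ.toSphere := by
  have hS : MeasurableSet {p : Metric.sphere (0 : E) 1 × Set.Ioi (0 : ℝ) | (p.2 : ℝ) < ρ p.1} :=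
    measurableSet_lt (by fun_prop) (by fun_prop)
  have hsub : ((↑) : ({0}ᶜ : Set E) → E) ⁻¹' C ⊆ homeomorphUnitSphereProd E ⁻¹'
      {p : Metric.sphere (0 : E) 1 × Set.Ioi (0 : ℝ) | (p.2 : ℝ) < ρ p.1} := by
    rintro x hx
    refine h _ _ (homeomorphUnitSphereProd E x).2.2 ?_
    rw [← homeomorphUnitSphereProd_symm_apply_coe, Homeomorph.symm_apply_apply]
    exact hx
  have hd : Module.finrank ℝ E - 1 + 1 = Module.finrank ℝ E :=
    Nat.sub_add_cancel Module.finrank_pos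
  calc μ C = μ (C \ {0}) := (measure_sdiff_null (measure_singleton _)).symm
    _ = μ.comap (↑) (((↑) : ({0}ᶜ : Set E) → E) ⁻¹' C) := by
        rw [(MeasurableEmbedding.subtype_coe (measurableSet_singleton _).compl).comap_apply,
          Subtype.image_preimage_coe, Set.inter_comm, Set.sdiff_eq]
    _ ≤ (μ.toSphere.prod (.volumeIoiPow (Module.finrank ℝ E - 1))) {p | (p.2 : ℝ) < ρ p.1} := by
        rw [← μ.measurePreserving_homeomorphUnitSphereProd.measure_preimage hS.nullMeasurableSet]
        exact measure_mono hsub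
    _ = ∫⁻ u, ENNReal.ofReal (ρ u ^ Module.finrank ℝ E / Module.finrank ℝ E) ∂μ.toSphere := by
        rw [Measure.prod_apply hS]
        refine lintegral_congr fun u => ?_
        have := Measure.volumeIoiPow_apply_Iio (Module.finrank ℝ E - 1) ⟨ρ u, hρ₀ u⟩
        rw [hd, ← Nat.cast_succ, Nat.succ_eq_add_one, hd] at this
        exact this

theorem Continuous.integrable_of_compactSpace {X : Type*} [TopologicalSpace X] [CompactSpace X]
    [MeasurableSpace X] [OpensMeasurableSpace X] {σ : Measure X} [IsFiniteMeasure σ] {g : X → ℝ}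
    (hg : Continuous g) : Integrable g σ :=
  hg.integrable_of_hasCompactSupport (HasCompactSupport.of_compactSpace g)

/-- If `t ↦ ∫ (1 + t * g) ^ n` is at least its value at `0` for small `t > 0`, then its derivative
at `0` is nonnegative. -/
theorem integral_nonneg_of_measure_le_integral_one_add_mul_pow {X : Type*} [TopologicalSpace X]
    [CompactSpace X] [MeasurableSpace X] [OpensMeasurableSpace X] {σ : Measure X}
    [IsFiniteMeasure σ] {g : X → ℝ} (hg : Continuous g) {n : ℕ} (hn : 0 < n)
    (h : ∀ t : ℝ, 0 < t → t < 1 → (∀ x, 0 < 1 + t * g x) →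
      σ.real Set.univ ≤ ∫ x, (1 + t * g x) ^ n ∂σ) :
    0 ≤ ∫ x, g x ∂σ := by
  obtain ⟨M, hM⟩ : ∃ M : ℝ, ∀ x, |g x| ≤ M := by
    obtain ⟨M, hM⟩ := isCompact_univ.exists_bound_of_continuousOn hg.continuousOn
    exact ⟨M, fun x => hM x (Set.mem_univ x)⟩
  set m := max M 1
  have hm₁ : 1 ≤ m := le_max_right _ _
  have hgm : ∀ x, |g x| ≤ m := fun x => (hM x).trans (le_max_left _ _)
  have hn₁ : (1 : ℝ) ≤ n := by exact_mod_cast hn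
  have hgi : Integrable g σ := hg.integrable_of_compactSpace
  have key : ∀ t : ℝ, 0 < t → t < 1 / (2 * n * m) →
      0 ≤ ∫ x, g x ∂σ + t * (n * m ^ 2 * σ.real Set.univ) := by
    intro t ht htm
    have htm' : t * n * m < 1 / 2 := by
      rw [lt_div_iff₀ (by positivity)] at htm
      linarith
    have htm₁ : t * m ≤ t * n * m := by nlinarith [mul_pos ht (one_pos.trans_le hm₁)]
    have ht₁ : t ≤ t * m := by nlinarith
    have hsmall : ∀ x, |t * g x| ≤ t * m := fun x => by
      rw [abs_mul, abs_of_pos ht]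
      exact mul_le_mul_of_nonneg_left (hgm x) ht.le
    have hpos : ∀ x, 0 < 1 + t * g x := fun x => by
      have := (abs_le.1 (hsmall x)).1
      linarith
    have hpt : ∀ x, (1 + t * g x) ^ n ≤ 1 + n * t * g x + (n * t * m) ^ 2 := fun x => by
      have hx : |n * (t * g x)| ≤ n * t * m := by
        rw [abs_mul, abs_of_nonneg (by positivity : (0 : ℝ) ≤ n), mul_assoc]
        exact mul_le_mul_of_nonneg_left (hsmall x) (by positivity)
      have h1 : (1 + t * g x) ^ n ≤ Real.exp (n * (t * g x)) := by
        rw [Real.exp_nat_mul]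
        refine pow_le_pow_left₀ (hpos x).le ?_ n
        linarith [Real.add_one_le_exp (t * g x)]
      have h2 := (abs_le.1 (Real.abs_exp_sub_one_sub_id_le (x := n * (t * g x))
        (hx.trans (by linarith)))).2
      have h3 : (n * (t * g x)) ^ 2 ≤ (n * t * m) ^ 2 := sq_le_sq' (abs_le.1 hx).1 (abs_le.1 hx).2
      linarith
    have hle : σ.real Set.univ ≤ ∫ x, (1 + n * t * g x + (n * t * m) ^ 2) ∂σ :=
      (h t ht (by linarith) hpos).trans
        (integral_mono (by fun_prop : Continuous _).integrable_of_compactSpace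
          (by fun_prop : Continuous _).integrable_of_compactSpace hpt)
    rw [integral_add (f := fun x => 1 + n * t * g x)
        ((integrable_const _).add (hgi.const_mul _)) (integrable_const _),
      integral_add (integrable_const _) (hgi.const_mul _), integral_const_mul, integral_const,
      integral_const, smul_eq_mul, smul_eq_mul, mul_one] at hle
    have hnt : 0 < n * t := by positivity
    refine nonneg_of_mul_nonneg_right ?_ hnt
    linarith
  have hlim : Filter.Tendsto (fun t : ℝ => ∫ x, g x ∂σ + t * (n * m ^ 2 * σ.real Set.univ))
      (nhdsWithin 0 (Set.Ioi 0)) (nhds (∫ x, g x ∂σ)) := by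
    have : Continuous fun t : ℝ => ∫ x, g x ∂σ + t * (n * m ^ 2 * σ.real Set.univ) := by fun_prop
    simpa using (this.tendsto 0).mono_left nhdsWithin_le_nhds
  refine ge_of_tendsto hlim ?_
  filter_upwards [Ioo_mem_nhdsGT (by positivity : (0 : ℝ) < 1 / (2 * n * m))] with t ht
  exact key t ht.1 ht.2

/-- The value at `u` of the support function of `K`. -/
noncomputable def supportFun {E : Type*} [NormedAddCommGroup E] [InnerProductSpace ℝ E]
    (K : Set E) (u : E) : ℝ :=
  sSup ((fun x => ⟪x, u⟫) '' K)

section Support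

variable {E : Type*} [NormedAddCommGroup E] [InnerProductSpace ℝ E] {K : Set E}

theorem IsCompact.inner_le_supportFun (hK : IsCompact K) {x : E} (hx : x ∈ K) (u : E) :
    ⟪x, u⟫ ≤ supportFun K u :=
  le_csSup (hK.image (by fun_prop)).bddAbove ⟨x, hx, rfl⟩

theorem IsCompact.continuous_supportFun (hK : IsCompact K) : Continuous (supportFun K) :=
  hK.continuous_sSup (f := fun u x => ⟪x, u⟫) (by unfold Function.HasUncurry.uncurry; fun_prop)

theorem supportFun_closedBall {u : E} (hu : ‖u‖ = 1) :
    supportFun (Metric.closedBall (0 : E) 1) u = 1 := by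
  refine IsGreatest.csSup_eq ⟨⟨u, by simp [hu], by simp [hu]⟩, ?_⟩
  rintro _ ⟨x, hx, rfl⟩
  have hx₁ : ‖x‖ ≤ 1 := by simpa using hx
  simpa [hu] using (real_inner_le_norm x u).trans (by simpa [hu] using hx₁)

end Support

theorem measure_toSphere_le_integral_supportFun {n : ℕ} (hn : 0 < n)
    {K : Set (EuclideanSpace ℝ (Fin n))} (hK : IsCompact K) {r ε : ℝ} (hr : 0 < r) (hε : 0 < ε)
    (hvol : volume K = ENNReal.ofReal (r ^ n) *
      volume (Metric.closedBall (0 : EuclideanSpace ℝ (Fin n)) 1))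
    {t : ℝ} (ht : 0 < t) (ht₁ : t < 1)
    (hpos : ∀ u : Metric.sphere (0 : EuclideanSpace ℝ (Fin n)) 1,
      0 < 1 + t * (supportFun K (u : EuclideanSpace ℝ (Fin n)) / r - 1 + ε)) :
    (volume : Measure (EuclideanSpace ℝ (Fin n))).toSphere.real Set.univ ≤
      ∫ u, (1 + t * (supportFun K (u : EuclideanSpace ℝ (Fin n)) / r - 1 + ε)) ^ n
        ∂(volume : Measure (EuclideanSpace ℝ (Fin n))).toSphere := by
  have : Nonempty (Fin n) := ⟨⟨0, hn⟩⟩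
  set A := Metric.closedBall (0 : EuclideanSpace ℝ (Fin n)) 1
  have hAc : IsCompact A := isCompact_closedBall _ _
  have hB : IsCompact (r⁻¹ • K) := hK.smul _
  have hC : IsCompact ((1 - t) • A + t • (r⁻¹ • K)) := (hAc.smul _).add (hB.smul _)
  have hvB : volume (r⁻¹ • K) = volume A := by
    rw [Measure.addHaar_smul, hvol, ← mul_assoc, ← ENNReal.ofReal_mul (abs_nonneg _)]
    simp [abs_of_pos hr, hr.ne']
  have hBM := (PrekopaLeindler.euclideanSpace n).brunn_minkowski (sub_pos.2 ht₁) ht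
    (sub_add_cancel 1 t) hAc.measurableSet hB.measurableSet hC.measurableSet fun x hx y hy =>
      Set.add_mem_add (Set.smul_mem_smul_set hx) (Set.smul_mem_smul_set hy)
  rw [hvB, ← ENNReal.rpow_add_of_nonneg _ _ (sub_nonneg.2 ht₁.le) ht.le, sub_add_cancel,
    ENNReal.rpow_one] at hBM
  have hcont : Continuous fun u : Metric.sphere (0 : EuclideanSpace ℝ (Fin n)) 1 =>
      1 + t * (supportFun K (u : EuclideanSpace ℝ (Fin n)) / r - 1 + ε) := by
    have := hK.continuous_supportFun.comp
      (continuous_subtype_val (p := (· ∈ Metric.sphere (0 : EuclideanSpace ℝ (Fin n)) 1)))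
    simp only [Function.comp_def] at this
    fun_prop
  have hle := hBM.trans (measure_le_lintegral_toSphere volume hcont.measurable hpos
    (by
      rintro u s hs hsC
      obtain ⟨_, ⟨p, hp, rfl⟩, _, ⟨_, ⟨k, hk, rfl⟩, rfl⟩, hsum⟩ := hsC
      have hu : ‖(u : EuclideanSpace ℝ (Fin n))‖ = 1 := by simp
      have hinner := congrArg (fun x => ⟪x, (u : EuclideanSpace ℝ (Fin n))⟫) hsum
      simp only [inner_add_left, real_inner_smul_left, real_inner_self_eq_norm_sq, hu] at hinner
      have h₁ := hAc.inner_le_supportFun hp (u : EuclideanSpace ℝ (Fin n))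
      rw [supportFun_closedBall hu] at h₁
      have h₂ := hK.inner_le_supportFun hk (u : EuclideanSpace ℝ (Fin n))
      have h₃ := mul_le_mul_of_nonneg_left h₁ (sub_nonneg.2 ht₁.le)
      have h₄ := mul_le_mul_of_nonneg_left
        (mul_le_mul_of_nonneg_left h₂ (inv_nonneg.2 hr.le)) ht.le
      have h₅ := mul_pos ht hε
      rw [div_eq_inv_mul]
      linarith))
  simp only [finrank_euclideanSpace, Fintype.card_fin] at hle
  rw [← ofReal_integral_eq_lintegral_ofReal
      (by fun_prop : Continuous _).integrable_of_compactSpace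
      (.of_forall fun u => div_nonneg (pow_nonneg (hpos u).le n) n.cast_nonneg),
    integral_div] at hle
  have h_nonneg : 0 ≤ ∫ u, (1 + t * (supportFun K (u : EuclideanSpace ℝ (Fin n)) / r - 1 + ε)) ^ n
        ∂(volume : Measure (EuclideanSpace ℝ (Fin n))).toSphere :=
    integral_nonneg fun u => pow_nonneg (hpos u).le n
  have hreal := ENNReal.toReal_mono ENNReal.ofReal_ne_top hle
  rw [ENNReal.toReal_ofReal (by positivity), le_div_iff₀ (by positivity)] at hreal
  rw [Measure.toSphere_real_apply_univ, finrank_euclideanSpace, Fintype.card_fin, mul_comm,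
    measureReal_def, ← Measure.addHaar_closedBall_eq_addHaar_ball]
  exact hreal

theorem le_average_supportFun {n : ℕ} (hn : 0 < n) {K : Set (EuclideanSpace ℝ (Fin n))}
    (hK : IsCompact K) {r : ℝ} (hr : 0 < r)
    (hvol : volume K = ENNReal.ofReal (r ^ n) *
      volume (Metric.closedBall (0 : EuclideanSpace ℝ (Fin n)) 1)) :
    r ≤ ⨍ u : Metric.sphere (0 : EuclideanSpace ℝ (Fin n)) 1,
      supportFun K (u : EuclideanSpace ℝ (Fin n))
        ∂(volume : Measure (EuclideanSpace ℝ (Fin n))).toSphere := by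
  have : Nonempty (Fin n) := ⟨⟨0, hn⟩⟩
  set σ := (volume : Measure (EuclideanSpace ℝ (Fin n))).toSphere
  have hσ₀ : 0 < σ.real Set.univ := by
    have : NeZero σ := ⟨Measure.toSphere_ne_zero _⟩
    exact measureReal_univ_pos
  have hcont : Continuous fun u : Metric.sphere (0 : EuclideanSpace ℝ (Fin n)) 1 =>
      supportFun K (u : EuclideanSpace ℝ (Fin n)) :=
    hK.continuous_supportFun.comp continuous_subtype_val
  have hi : Integrable (fun u : Metric.sphere (0 : EuclideanSpace ℝ (Fin n)) 1 =>
      supportFun K (u : EuclideanSpace ℝ (Fin n))) σ := hcont.integrable_of_compactSpace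
  rw [average_eq, smul_eq_mul, ← div_eq_inv_mul, le_div_iff₀ hσ₀]
  refine le_of_forall_pos_le_add fun δ hδ => ?_
  have hε : 0 < δ / (r * σ.real Set.univ) := by positivity
  have h := integral_nonneg_of_measure_le_integral_one_add_mul_pow (σ := σ)
    (by fun_prop : Continuous fun u : Metric.sphere (0 : EuclideanSpace ℝ (Fin n)) 1 =>
      supportFun K (u : EuclideanSpace ℝ (Fin n)) / r - 1 + δ / (r * σ.real Set.univ)) hn
    fun t ht ht₁ hpos => measure_toSphere_le_integral_supportFun hn hK hr hε hvol ht ht₁ hpos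
  rw [integral_add (f := fun u : Metric.sphere (0 : EuclideanSpace ℝ (Fin n)) 1 =>
        supportFun K (u : EuclideanSpace ℝ (Fin n)) / r - 1)
      ((hi.div_const r).sub (integrable_const _)) (integrable_const _),
    integral_sub (hi.div_const r) (integrable_const _), integral_div, integral_const,
    integral_const, smul_eq_mul, smul_eq_mul] at h
  field_simp at h
  linarith

theorem meanWidth_eq {n : ℕ} (K : Set (EuclideanSpace ℝ (Fin n))) :
    meanWidth K = 2 * ⨍ u : Metric.sphere (0 : EuclideanSpace ℝ (Fin n)) 1,
      supportFun K (u : EuclideanSpace ℝ (Fin n))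
        ∂(volume : Measure (EuclideanSpace ℝ (Fin n))).toSphere := rfl

theorem meanWidth_closedBall {n : ℕ} (hn : 0 < n) :
    meanWidth (Metric.closedBall (0 : EuclideanSpace ℝ (Fin n)) 1) = 2 := by
  have : Nonempty (Fin n) := ⟨⟨0, hn⟩⟩
  have : NeZero (volume : Measure (EuclideanSpace ℝ (Fin n))).toSphere :=
    ⟨Measure.toSphere_ne_zero _⟩
  have h : (fun u : Metric.sphere (0 : EuclideanSpace ℝ (Fin n)) 1 =>
      supportFun (Metric.closedBall 0 1) (u : EuclideanSpace ℝ (Fin n))) = fun _ => (1 : ℝ) :=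
    funext fun u => supportFun_closedBall (by simp)
  rw [meanWidth_eq, h, average_const, mul_one]

theorem urysohn {n : ℕ} (K : Set (EuclideanSpace ℝ (Fin n)))
    (hK : Convex ℝ K) (hKc : IsCompact K) (hKi : (interior K).Nonempty) :
    volume K ≤
      ENNReal.ofReal
          ((meanWidth K / meanWidth (Metric.closedBall (0 : EuclideanSpace ℝ (Fin n)) 1)) ^ n) *
        volume (Metric.closedBall (0 : EuclideanSpace ℝ (Fin n)) 1) := by
  rcases Nat.eq_zero_or_pos n with rfl | hn
  · have : Metric.closedBall (0 : EuclideanSpace ℝ (Fin 0)) 1 = Set.univ :=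
      Set.eq_univ_of_forall fun x => by simp [Subsingleton.elim x 0]
    rw [this, pow_zero, ENNReal.ofReal_one, one_mul]
    exact measure_mono (Set.subset_univ K)
  set B := Metric.closedBall (0 : EuclideanSpace ℝ (Fin n)) 1
  have hB₀ : volume B ≠ 0 := (Metric.measure_closedBall_pos _ _ one_pos).ne'
  have hBt : volume B ≠ ∞ := measure_closedBall_lt_top.ne
  have hK₀ : volume K ≠ 0 := (Measure.measure_pos_of_nonempty_interior _ hKi).ne'
  have hKt : volume K ≠ ∞ := hKc.measure_ne_top
  have hq₀ : 0 < (volume K / volume B).toReal :=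
    ENNReal.toReal_pos (ENNReal.div_ne_zero.2 ⟨hK₀, hBt⟩) (ENNReal.div_ne_top hKt hB₀)
  set r := (volume K / volume B).toReal ^ (n : ℝ)⁻¹ with hr
  have hr₀ : 0 < r := Real.rpow_pos_of_pos hq₀ _
  have hvol : volume K = ENNReal.ofReal (r ^ n) * volume B := by
    rw [hr, Real.rpow_inv_natCast_pow hq₀.le hn.ne',
      ENNReal.ofReal_toReal (ENNReal.div_ne_top hKt hB₀), ENNReal.div_mul_cancel hB₀ hBt]
  have hle : r ≤ meanWidth K / meanWidth B := by
    rw [meanWidth_closedBall hn, meanWidth_eq, mul_div_cancel_left₀ _ two_ne_zero]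
    exact le_average_supportFun hn hKc hr₀ hvol
  calc volume K = ENNReal.ofReal (r ^ n) * volume B := hvol
    _ ≤ _ := by gcongr
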